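/- arXiv:2311.08376 — 3 statements merged into one kernel-verified Lean document; each statement's English description precedes it below -/
import Mathlib

section
/- Let F : ℝ^d → ℝ be a convex function and let u be a maximizer of F over the closed unit ball of ℝ^d. Then for any v ∈ ℝ^d with ⟨v, u⟩ ≥ 1, we have F(v) ≥ F(u). -/
/-- A maximizer `u` of a convex function over the Euclidean unit ball minimizes it over the open
half-space `1 < ⟨w, u⟩`: the line from `w` through `u` re-enters the ball behind `u`. -/
theorem ConvexOn.le_of_one_lt_sum_mul_of_max_unitBall {ι : Type*} [Fintype ι]
    {F : (ι → ℝ) → ℝ} (hF : ConvexOn ℝ Set.univ F) {u : ι → ℝ} (hu : ∑ i, u i ^ 2 ≤ 1)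
    (hmax : ∀ z : ι → ℝ, ∑ i, z i ^ 2 ≤ 1 → F z ≤ F u)
    {w : ι → ℝ} (hw : 1 < ∑ i, w i * u i) : F u ≤ F w := by
  set a := ∑ i, w i * u i - 1 with ha
  set D := ∑ i, (u i - w i) ^ 2 with hD
  have hD0 : 0 ≤ D := Finset.sum_nonneg fun i _ => sq_nonneg _
  have ha0 : 0 < a := by linarith
  obtain ⟨t, ht0, htD⟩ : ∃ t : ℝ, 0 < t ∧ t * D ≤ a := by
    refine ⟨a / (D + 1), by positivity, ?_⟩
    rw [div_mul_eq_mul_div, div_le_iff₀ (by positivity)]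
    nlinarith
  have hz : F (u + t • (u - w)) ≤ F u := by
    apply hmax
    have hexpand : ∑ i, (u + t • (u - w)) i ^ 2
        = (1 + 2 * t) * ∑ i, u i ^ 2 - 2 * t * ∑ i, w i * u i + t * (t * D) := by
      simp only [hD, Finset.mul_sum, ← Finset.sum_sub_distrib, ← Finset.sum_add_distrib]
      refine Finset.sum_congr rfl fun i _ => ?_
      simp only [Pi.add_apply, Pi.smul_apply, Pi.sub_apply, smul_eq_mul]
      ring
    rw [hexpand]
    nlinarith [mul_le_mul_of_nonneg_left htD ht0.le, mul_le_mul_of_nonneg_left hu ht0.le,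
      mul_pos ht0 ha0]
  have hconv := hF.2 (Set.mem_univ (u + t • (u - w))) (Set.mem_univ w)
    (show 0 ≤ 1 / (1 + t) by positivity) (show 0 ≤ t / (1 + t) by positivity) (by field_simp)
  have hcomb : (1 / (1 + t)) • (u + t • (u - w)) + (t / (1 + t)) • w = u := by
    ext i
    simp only [Pi.add_apply, Pi.smul_apply, Pi.sub_apply, smul_eq_mul]
    field_simp
    ring
  rw [hcomb, smul_eq_mul, smul_eq_mul, div_mul_eq_mul_div, div_mul_eq_mul_div, ← add_div,
    le_div_iff₀ (by positivity)] at hconv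
  exact le_of_mul_le_mul_left (by linarith) ht0

/-- If `F : ℝ^d → ℝ` is convex and `u` maximizes `F` over the closed unit
ball, then for any `v` with `⟨v, u⟩ ≥ 1` we have `F(v) ≥ F(u)`. -/
theorem stmt_15 {d : ℕ} (F : (Fin d → ℝ) → ℝ)
    (hF : ConvexOn ℝ Set.univ F)
    (u : Fin d → ℝ) (hu : Real.sqrt (∑ i, u i ^ 2) ≤ 1)
    (hmax : ∀ z : Fin d → ℝ, Real.sqrt (∑ i, z i ^ 2) ≤ 1 → F z ≤ F u)
    (v : Fin d → ℝ) (hv : 1 ≤ ∑ i, v i * u i) :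
    F u ≤ F v := by
  simp only [Real.sqrt_le_one] at hu hmax
  have hscaled : ∀ e : ℝ, 0 < e → e ≤ 1 → F u ≤ (1 - e) * F v + e * F ((2 : ℝ) • v) := by
    intro e he0 he1
    have hsum : ∑ i, ((1 - e) • v + e • (2 : ℝ) • v) i * u i = (1 + e) * ∑ i, v i * u i := by
      rw [Finset.mul_sum]
      refine Finset.sum_congr rfl fun i _ => ?_
      simp only [Pi.add_apply, Pi.smul_apply, smul_eq_mul]
      ring
    refine (hF.le_of_one_lt_sum_mul_of_max_unitBall hu hmax
      (w := (1 - e) • v + e • (2 : ℝ) • v) ?_).trans ?_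
    · rw [hsum]
      nlinarith
    · simpa only [smul_eq_mul] using hF.2 (Set.mem_univ v) (Set.mem_univ ((2 : ℝ) • v))
        (sub_nonneg.2 he1) he0.le (sub_add_cancel 1 e)
  have hlim : Filter.Tendsto (fun e : ℝ => (1 - e) * F v + e * F ((2 : ℝ) • v))
      (nhdsWithin 0 (Set.Ioi 0)) (nhds (F v)) := by
    have hcont : Continuous fun e : ℝ => (1 - e) * F v + e * F ((2 : ℝ) • v) := by fun_prop
    simpa using (hcont.tendsto 0).mono_left nhdsWithin_le_nhds
  refine ge_of_tendsto hlim ?_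
  filter_upwards [Ioc_mem_nhdsGT (zero_lt_one' ℝ)] with e he
  exact hscaled e he.1 he.2
end

section
/- Let b_1, b_2, … be a sequence of real numbers in [0,1]. Then for any λ > 0 and n ∈ ℕ+: Σ_{j=1}^n b_j/(λ + Σ_{i=1}^j b_i) ≤ log(1 + n/λ), and Σ_{j=1}^n ( b_j/(λ + Σ_{i=1}^j b_i) )² ≤ n/(λ(λ+n)) ≤ 1/λ. -/
open Finset in
/-- If each `b i` is nonnegative, `b j / (lam + ∑ i ≤ j, b i)` sums to at most the telescoped
increments of `log`. -/
theorem sum_div_add_sum_le_log_sub_log {b : ℕ → ℝ} (hb : ∀ i, 0 ≤ b i) {lam : ℝ} (hlam : 0 < lam)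
    (n : ℕ) :
    ∑ j ∈ Icc 1 n, b j / (lam + ∑ i ∈ Icc 1 j, b i)
      ≤ Real.log (lam + ∑ i ∈ Icc 1 n, b i) - Real.log lam := by
  induction n with
  | zero => simp
  | succ n ih =>
    have hprev : 0 < lam + ∑ i ∈ Icc 1 n, b i :=
      add_pos_of_pos_of_nonneg hlam (sum_nonneg fun i _ => hb i)
    have hstep := hb (n + 1)
    rw [sum_Icc_succ_top (by omega), sum_Icc_succ_top (by omega), ← add_assoc]
    set s := lam + ∑ i ∈ Icc 1 n, b i
    have hnext : 0 < s + b (n + 1) := by positivity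
    have hlog := Real.one_sub_inv_le_log_of_pos (div_pos hnext hprev)
    rw [Real.log_div hnext.ne' hprev.ne', inv_div, one_sub_div hnext.ne', add_sub_cancel_left]
      at hlog
    linarith

open Finset in
/-- If each `b i` lies in `[0, 1]`, the squares of `b j / (lam + ∑ i ≤ j, b i)` sum to at most the
telescoped decrements of the inverse. -/
theorem sum_sq_div_add_sum_le_inv_sub_inv {b : ℕ → ℝ} (hb : ∀ i, b i ∈ Set.Icc (0 : ℝ) 1) {lam : ℝ}
    (hlam : 0 < lam) (n : ℕ) :
    ∑ j ∈ Icc 1 n, (b j / (lam + ∑ i ∈ Icc 1 j, b i)) ^ 2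
      ≤ lam⁻¹ - (lam + ∑ i ∈ Icc 1 n, b i)⁻¹ := by
  induction n with
  | zero => simp
  | succ n ih =>
    have hprev : 0 < lam + ∑ i ∈ Icc 1 n, b i :=
      add_pos_of_pos_of_nonneg hlam (sum_nonneg fun i _ => (hb i).1)
    obtain ⟨hstep, hstep_le⟩ := hb (n + 1)
    rw [sum_Icc_succ_top (by omega), sum_Icc_succ_top (by omega), ← add_assoc]
    set s := lam + ∑ i ∈ Icc 1 n, b i
    have hnext : 0 < s + b (n + 1) := by positivity
    have hsq : (b (n + 1) / (s + b (n + 1))) ^ 2 ≤ s⁻¹ - (s + b (n + 1))⁻¹ := by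
      rw [inv_sub_inv hprev.ne' hnext.ne', add_sub_cancel_left, div_pow]
      apply div_le_div₀ hstep (by nlinarith) (by positivity) (by nlinarith)
    linarith

/-- For a sequence `b₁, b₂, …` of reals in `[0,1]`, any `λ > 0` and `n ≥ 1`:
`Σ_{j=1}^n b_j/(λ + Σ_{i=1}^j b_i) ≤ log(1 + n/λ)` and
`Σ_{j=1}^n (b_j/(λ + Σ_{i=1}^j b_i))² ≤ n/(λ(λ+n)) ≤ 1/λ`. -/
theorem stmt_17 (b : ℕ → ℝ) (hb : ∀ i, b i ∈ Set.Icc (0 : ℝ) 1)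
    (lam : ℝ) (hlam : 0 < lam) (n : ℕ) (hn : 1 ≤ n) :
    (∑ j ∈ Finset.Icc 1 n, b j / (lam + ∑ i ∈ Finset.Icc 1 j, b i)
        ≤ Real.log (1 + n / lam)) ∧
    (∑ j ∈ Finset.Icc 1 n, (b j / (lam + ∑ i ∈ Finset.Icc 1 j, b i)) ^ 2
        ≤ n / (lam * (lam + n))) ∧
    (n : ℝ) / (lam * (lam + n)) ≤ 1 / lam := by
  have hsum : ∑ i ∈ Finset.Icc 1 n, b i ≤ n := by
    simpa using Finset.sum_le_card_nsmul (Finset.Icc 1 n) b 1 fun i _ => (hb i).2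
  have hpos : 0 < lam + ∑ i ∈ Finset.Icc 1 n, b i :=
    add_pos_of_pos_of_nonneg hlam (Finset.sum_nonneg fun i _ => (hb i).1)
  have hlam_add : 0 < lam + n := by positivity
  have hdiff : (n : ℝ) / (lam * (lam + n)) = lam⁻¹ - (lam + n)⁻¹ := by
    rw [inv_sub_inv hlam.ne' hlam_add.ne', add_sub_cancel_left]
  refine ⟨?_, ?_, ?_⟩
  · refine (sum_div_add_sum_le_log_sub_log (fun i => (hb i).1) hlam n).trans ?_
    rw [one_add_div hlam.ne', Real.log_div hlam_add.ne' hlam.ne']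
    gcongr
  · refine (sum_sq_div_add_sum_le_inv_sub_inv hb hlam n).trans ?_
    rw [hdiff]
    gcongr
  · rw [hdiff, one_div]
    exact sub_le_self _ (inv_nonneg.mpr hlam_add.le)
end

section
/- In the linear ensemble sampling process with λ ≥ 5, for any 0 ≤ τ ≤ t < T: 1 + Σ_{i=τ}^t σ_i² ≤ 3 + Σ_{i=τ}^t Q_i R_i, where σ_i = √(2Q_i² + Q_i R_i). -/
noncomputable section

/-- Euclidean inner product on `ℝ^d`. -/
def dotp {d : ℕ} (u v : Fin d → ℝ) : ℝ := ∑ i, u i * v i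

/-- Outer product `u uᵀ`. -/
def outer {d : ℕ} (u : Fin d → ℝ) : Matrix (Fin d) (Fin d) ℝ := fun i j => u i * u j

/-- Design matrix `V_t = λ I + Σ_{i=1}^t X_i X_iᵀ`. -/
def Vmat {d : ℕ} (lam : ℝ) (X : ℕ → Fin d → ℝ) (t : ℕ) : Matrix (Fin d) (Fin d) ℝ :=
  lam • (1 : Matrix (Fin d) (Fin d) ℝ) + ∑ i ∈ Finset.Icc 1 t, outer (X i)

theorem dotp_mulVec_outer {d : ℕ} (u x : Fin d → ℝ) :
    dotp u ((outer x).mulVec u) = dotp u x ^ 2 := by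
  simp only [dotp, outer, Matrix.mulVec, dotProduct, sq, Finset.mul_sum,
    Finset.sum_mul]
  rw [Finset.sum_comm]
  exact Finset.sum_congr rfl fun i _ => Finset.sum_congr rfl fun j _ => by ring

theorem dotp_mulVec_Vmat_zero {d : ℕ} (lam : ℝ) (X : ℕ → Fin d → ℝ) (u : Fin d → ℝ) :
    dotp u ((Vmat lam X 0).mulVec u) = lam * ∑ i, u i ^ 2 := by
  simp only [Vmat, Finset.Icc_eq_empty_of_lt Nat.zero_lt_one, Finset.sum_empty, add_zero,
    Matrix.smul_mulVec, Matrix.one_mulVec, dotp, Pi.smul_apply, smul_eq_mul, Finset.mul_sum]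
  exact Finset.sum_congr rfl fun i _ => by ring

theorem dotp_mulVec_Vmat_succ {d : ℕ} (lam : ℝ) (X : ℕ → Fin d → ℝ) (u : Fin d → ℝ) (t : ℕ) :
    dotp u ((Vmat lam X (t + 1)).mulVec u) =
      dotp u ((Vmat lam X t).mulVec u) + dotp u (X (t + 1)) ^ 2 := by
  have hV : Vmat lam X (t + 1) = Vmat lam X t + outer (X (t + 1)) := by
    rw [Vmat, Vmat, Finset.sum_Icc_succ_top (by omega), add_assoc]
  rw [hV, Matrix.add_mulVec, ← dotp_mulVec_outer]
  simp only [dotp, Pi.add_apply, mul_add, Finset.sum_add_distrib]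

/-- A squared relative increment of at most unit size is bounded by the decrease of the
reciprocal. -/
theorem sq_div_add_le_inv_sub_inv {a b : ℝ} (ha : 0 ≤ a) (ha1 : a ≤ 1) (hb : 0 < b) :
    (a / (b + a)) ^ 2 ≤ b⁻¹ - (b + a)⁻¹ := by
  have hba : 0 < b + a := by linarith
  rw [inv_sub_inv hb.ne' hba.ne', add_sub_cancel_left, div_pow,
    div_le_div_iff₀ (by positivity) (by positivity)]
  have : a ^ 2 * b ≤ a * (b + a) := by nlinarith [mul_nonneg ha hb.le]
  calc a ^ 2 * (b * (b + a)) = a ^ 2 * b * (b + a) := by ring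
    _ ≤ a * (b + a) * (b + a) := by gcongr
    _ = a * (b + a) ^ 2 := by ring

/-- If `b` has increments `a i ∈ [0, 1]` and starts at a positive value, then the squared
relative increments sum to at most `(b 0)⁻¹`. -/
theorem sum_sq_div_le_inv {a b : ℕ → ℝ} (ha : ∀ i, 0 ≤ a i) (ha1 : ∀ i, a i ≤ 1)
    (hb0 : 0 < b 0) (hb : ∀ i, b (i + 1) = b i + a i) (s : Finset ℕ) :
    ∑ i ∈ s, (a i / b (i + 1)) ^ 2 ≤ (b 0)⁻¹ := by
  have hpos : ∀ i, 0 < b i := fun i => by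
    induction i with
    | zero => exact hb0
    | succ k ih => rw [hb]; linarith [ha k]
  obtain ⟨n, hn⟩ := s.exists_nat_subset_range
  calc ∑ i ∈ s, (a i / b (i + 1)) ^ 2
      ≤ ∑ i ∈ Finset.range n, (a i / b (i + 1)) ^ 2 :=
        Finset.sum_le_sum_of_subset_of_nonneg hn fun _ _ _ => sq_nonneg _
    _ ≤ ∑ i ∈ Finset.range n, ((b i)⁻¹ - (b (i + 1))⁻¹) :=
        Finset.sum_le_sum fun i _ => by
          rw [hb]; exact sq_div_add_le_inv_sub_inv (ha i) (ha1 i) (hpos i)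
    _ = (b 0)⁻¹ - (b n)⁻¹ := Finset.sum_range_sub' (fun i => (b i)⁻¹) n
    _ ≤ (b 0)⁻¹ := sub_le_self _ (inv_nonneg.mpr (hpos n).le)

/-- In the linear ensemble sampling process with `λ ≥ 5`, where
`S_t^j = S_0^j + Σ_{i=1}^t U_i^j X_i`, `R_t = (1/m) Σ_j ⟨u,S_t^j⟩²/‖u‖²_{V_t}`,
`Q_t = ⟨u,X_{t+1}⟩²/‖u‖²_{V_{t+1}}`, `σ_i = √(2Q_i² + Q_i R_i)`: for any
`0 ≤ τ ≤ t < T`, `1 + Σ_{i=τ}^t σ_i² ≤ 3 + Σ_{i=τ}^t Q_i R_i`. -/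
theorem stmt_19 {d m : ℕ} (hd : 0 < d) (hm : 0 < m)
    (T : ℕ) (lam : ℝ) (hlam : 5 ≤ lam)
    (u : Fin d → ℝ) (hu : ∑ i, u i ^ 2 = 1)
    (X : ℕ → Fin d → ℝ) (hX : ∀ i, 1 ≤ i → Real.sqrt (∑ k, X i k ^ 2) ≤ 1)
    (U : ℕ → Fin m → ℝ) (hU : ∀ i j, U i j ∈ Set.Icc (-1 : ℝ) 1)
    (S0 : Fin m → Fin d → ℝ)
    (S : ℕ → Fin m → Fin d → ℝ)
    (hS : ∀ t j, S t j = S0 j + ∑ i ∈ Finset.Icc 1 t, U i j • X i)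
    (R Q σ : ℕ → ℝ)
    (hR : ∀ t, R t = (1 / (m : ℝ)) *
      ∑ j, dotp u (S t j) ^ 2 / dotp u ((Vmat lam X t).mulVec u))
    (hQ : ∀ t, Q t = dotp u (X (t + 1)) ^ 2 / dotp u ((Vmat lam X (t + 1)).mulVec u))
    (hσ : ∀ i, σ i = Real.sqrt (2 * Q i ^ 2 + Q i * R i)) :
    ∀ τ t : ℕ, τ ≤ t → t < T →
      1 + ∑ i ∈ Finset.Icc τ t, σ i ^ 2 ≤ 3 + ∑ i ∈ Finset.Icc τ t, Q i * R i := by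
  intro τ t _ _
  have hb0 : dotp u ((Vmat lam X 0).mulVec u) = lam := by
    rw [dotp_mulVec_Vmat_zero, hu, mul_one]
  have hVpos : ∀ i, 0 < dotp u ((Vmat lam X i).mulVec u) := fun i => by
    induction i with
    | zero => rw [hb0]; linarith
    | succ k ih => rw [dotp_mulVec_Vmat_succ]; positivity
  have hXu : ∀ i, dotp u (X (i + 1)) ^ 2 ≤ 1 := fun i => by
    have hX1 : ∑ k, X (i + 1) k ^ 2 ≤ 1 := by
      simpa using (Real.sqrt_le_iff.mp (hX (i + 1) (by omega))).2
    calc dotp u (X (i + 1)) ^ 2 ≤ (∑ k, u k ^ 2) * ∑ k, X (i + 1) k ^ 2 :=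
          Finset.sum_mul_sq_le_sq_mul_sq _ _ _
      _ ≤ 1 := by rwa [hu, one_mul]
  have hQsum : ∑ i ∈ Finset.Icc τ t, Q i ^ 2 ≤ 1 := by
    calc ∑ i ∈ Finset.Icc τ t, Q i ^ 2 ≤ (dotp u ((Vmat lam X 0).mulVec u))⁻¹ := by
          simp only [hQ]
          exact sum_sq_div_le_inv (a := fun i => dotp u (X (i + 1)) ^ 2)
            (b := fun i => dotp u ((Vmat lam X i).mulVec u)) (fun _ => sq_nonneg _) hXu
            (hVpos 0) (fun i => dotp_mulVec_Vmat_succ lam X u i) _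
      _ ≤ 1 := by rw [hb0]; exact inv_le_one_of_one_le₀ (by linarith)
  have hσsq : ∀ i, σ i ^ 2 = 2 * Q i ^ 2 + Q i * R i := fun i => by
    have hQ0 : 0 ≤ Q i := by
      rw [hQ]; exact div_nonneg (sq_nonneg _) (hVpos _).le
    have hR0 : 0 ≤ R i := by
      rw [hR]
      exact mul_nonneg (by positivity)
        (Finset.sum_nonneg fun j _ => div_nonneg (sq_nonneg _) (hVpos i).le)
    rw [hσ, Real.sq_sqrt (by positivity)]
  simp only [hσsq, Finset.sum_add_distrib, ← Finset.mul_sum]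
  linarith
end
end
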